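/- arXiv:2601.12408 — 2 statements merged into one kernel-verified Lean document; each statement's English description precedes it below -/
import Mathlib

section
/- Let A be a 2n×2n real symmetric positive semidefinite matrix whose kernel is a symplectic subspace of R^{2n}. Then there exists a real symplectic matrix M such that M^T A M = D ⊕ D, where D is an n×n diagonal matrix with non-negative diagonal entries, and the diagonal entries of D are unique up to permutation. -/
open Matrix BigOperators

/-- The standard symplectic form matrix `J = [[0, I], [-I, 0]]`. -/
def Jm (ι : Type*) [Fintype ι] [DecidableEq ι] : Matrix (ι ⊕ ι) (ι ⊕ ι) ℝ :=
  Matrix.fromBlocks 0 1 (-1) 0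

/-- A real `2n × 2n` matrix is symplectic if `Mᵀ J M = J`. -/
def IsSymplectic {ι : Type*} [Fintype ι] [DecidableEq ι]
    (M : Matrix (ι ⊕ ι) (ι ⊕ ι) ℝ) : Prop :=
  Mᵀ * Jm ι * M = Jm ι

/-- A subspace `W` of `ℝ^{2n}` is symplectic if every nonzero `u ∈ W` pairs
nontrivially via `J` with some `v ∈ W`. -/
def IsSymplecticSubspace {ι : Type*} [Fintype ι] [DecidableEq ι]
    (W : Submodule ℝ ((ι ⊕ ι) → ℝ)) : Prop :=
  ∀ u ∈ W, u ≠ 0 → ∃ v ∈ W, u ⬝ᵥ (Jm ι).mulVec v ≠ 0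

/-- `A` has symplectic kernel. -/
def HasSymplecticKernel {ι : Type*} [Fintype ι] [DecidableEq ι]
    (A : Matrix (ι ⊕ ι) (ι ⊕ ι) ℝ) : Prop :=
  IsSymplecticSubspace (LinearMap.ker A.mulVecLin)

/-- `d` is a vector of symplectic eigenvalues of `A` (Williamson diagonalization). -/
def IsSympSpectrum {ι : Type*} [Fintype ι] [DecidableEq ι]
    (A : Matrix (ι ⊕ ι) (ι ⊕ ι) ℝ) (d : ι → ℝ) : Prop :=
  ∃ M : Matrix (ι ⊕ ι) (ι ⊕ ι) ℝ, IsSymplectic M ∧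
    Mᵀ * A * M = Matrix.fromBlocks (Matrix.diagonal d) 0 0 (Matrix.diagonal d)

/-- Doubly stochastic matrix. -/
def DoublyStochastic {n : ℕ} (E : Matrix (Fin n) (Fin n) ℝ) : Prop :=
  (∀ i j, 0 ≤ E i j) ∧ (∀ i, ∑ j, E i j = 1) ∧ (∀ j, ∑ i, E i j = 1)

/-- Doubly superstochastic matrix: entrywise dominates a doubly stochastic matrix. -/
def DoublySuperstochastic {n : ℕ} (S : Matrix (Fin n) (Fin n) ℝ) : Prop :=
  ∃ E, DoublyStochastic E ∧ ∀ i j, E i j ≤ S i j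

/-- `X` lies in the convex hull of the symplectic orbit of `B`. -/
def InSympHull {ι : Type*} [Fintype ι] [DecidableEq ι]
    (B X : Matrix (ι ⊕ ι) (ι ⊕ ι) ℝ) : Prop :=
  ∃ (m : ℕ) (p : Fin m → ℝ) (M : Fin m → Matrix (ι ⊕ ι) (ι ⊕ ι) ℝ),
    (∀ i, 0 ≤ p i) ∧ (∑ i, p i = 1) ∧ (∀ i, IsSymplectic (M i)) ∧
    X = ∑ i, p i • ((M i)ᵀ * B * M i)

/-- Sum of the `k` smallest entries of `x`. -/
noncomputable def psum {n : ℕ} (x : Fin n → ℝ) (k : ℕ) : ℝ :=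
  ∑ j ∈ Finset.univ.filter (fun j : Fin n => (j : ℕ) < k), x (Tuple.sort x j)

/-- A vector isotropic for a positive semidefinite symmetric bilinear form lies in its kernel. -/
lemma apply_eq_zero_of_apply_self_eq_zero {V : Type*} [AddCommGroup V] [Module ℝ V]
    {q : LinearMap.BilinForm ℝ V} (hs : ∀ x y, q x y = q y x) (hp : ∀ x, 0 ≤ q x x)
    {x : V} (hx : q x x = 0) (y : V) : q x y = 0 := by
  by_contra h
  have h1 := hp (y + (-(q y y + 1) / (2 * q x y)) • x)
  simp only [map_add, map_smul, LinearMap.add_apply, LinearMap.smul_apply, smul_eq_mul, hx,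
    hs y x] at h1
  have h2 : (q y y + 1) / (2 * q x y) * q x y = (q y y + 1) / 2 := by field_simp
  rw [neg_div] at h1
  linarith

/-- A symmetric operator for a positive definite bilinear form has an eigenvector. -/
lemma exists_eigenvector_of_posDef {V : Type*} [AddCommGroup V] [Module ℝ V]
    [FiniteDimensional ℝ V] [Nontrivial V] {q : LinearMap.BilinForm ℝ V} (hs : ∀ x y, q x y = q y x)
    (hp : ∀ x, 0 ≤ q x x) (hd : ∀ x, q x x = 0 → x = 0)
    (T : V →ₗ[ℝ] V) (hT : ∀ x y, q (T x) y = q x (T y)) :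
    ∃ (μ : ℝ) (x : V), x ≠ 0 ∧ T x = μ • x := by
  let core : InnerProductSpace.Core ℝ V :=
    { inner := fun x y => q x y
      conj_inner_symm := fun x y => by simp [hs x y]
      re_inner_nonneg := fun x => by simpa using hp x
      add_left := fun x y z => by simp
      smul_left := fun x y r => by simp
      definite := hd }
  let : NormedAddCommGroup V := core.toNormedAddCommGroup
  let : InnerProductSpace ℝ V := InnerProductSpace.ofCore core.toCore
  have hT' : T.IsSymmetric := hT
  obtain ⟨x, hx⟩ := hT'.hasEigenvalue_iSup_of_finiteDimensional.exists_hasEigenvector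
  exact ⟨_, x, hx.2, hx.apply_eq_smul⟩

/-- For a positive definite `q` and a symplectic form `ω`, there is a symplectic plane on which
`q` is a multiple of the identity and whose `ω`-complement is also its `q`-complement. -/
lemma exists_symplectic_plane_of_posDef {V : Type*} [AddCommGroup V] [Module ℝ V]
    [FiniteDimensional ℝ V] [Nontrivial V] {ω q : LinearMap.BilinForm ℝ V}
    (ha : ∀ x y, ω x y = -ω y x) (hnd : ∀ x, (∀ y, ω x y = 0) → x = 0)
    (hs : ∀ x y, q x y = q y x) (hp : ∀ x, 0 ≤ q x x) (hd : ∀ x, q x x = 0 → x = 0) :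
    ∃ (u v : V) (d : ℝ), ω u v = 1 ∧ q u u = d ∧ q v v = d ∧ q u v = 0 ∧
      ∀ w, ω u w = 0 → ω v w = 0 → q u w = 0 ∧ q v w = 0 := by
  have hq : q.Nondegenerate := by
    refine ⟨fun x hx => hd x (hx x), fun x hx => hd x (hx x)⟩
  let T := ω.symmCompOfNondegenerate q hq
  have hT : ∀ x y, q (T x) y = ω x y := fun x y =>
    LinearMap.BilinForm.symmCompOfNondegenerate_left_apply ω hq y x
  have hskew : ∀ x y, q (T x) y = -q x (T y) := fun x y => by
    rw [hT, ha, ← hT, hs x]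
  obtain ⟨μ, x, hx0, hx⟩ := exists_eigenvector_of_posDef hs hp hd (T ∘ₗ T) fun x y => by
    simp only [LinearMap.comp_apply]
    rw [hskew, hskew, neg_neg]
  simp only [LinearMap.comp_apply] at hx
  have hN : 0 < q x x := (hp x).lt_of_ne fun h => hx0 (hd x h.symm)
  have hTx0 : T x ≠ 0 := fun h => hx0 (hnd x fun y => by rw [← hT, h]; simp)
  have hNT : 0 < q (T x) (T x) := (hp _).lt_of_ne fun h => hTx0 (hd _ h.symm)
  have hμN : q (T x) (T x) = -μ * q x x := by
    have h := hskew (T x) x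
    rw [hx] at h
    simp only [map_smul, LinearMap.smul_apply, smul_eq_mul] at h
    linarith
  have hμ : 0 < -μ := by
    rw [hμN] at hNT
    exact pos_of_mul_pos_left hNT hN.le
  obtain ⟨m, hm, hmμ⟩ : ∃ m : ℝ, 0 < m ∧ m ^ 2 = -μ :=
    ⟨√(-μ), Real.sqrt_pos.2 hμ, Real.sq_sqrt hμ.le⟩
  have hxTx : q x (T x) = 0 := by
    have h := hskew x x
    rw [hs] at h
    linarith
  obtain ⟨t, ht, htm⟩ : ∃ t : ℝ, 0 < t ∧ t ^ 2 * (m ^ 3 * q x x) = 1 := by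
    refine ⟨√((m ^ 3 * q x x)⁻¹), Real.sqrt_pos.2 (by positivity), ?_⟩
    rw [Real.sq_sqrt (by positivity)]
    exact inv_mul_cancel₀ (by positivity)
  have hmul : ∀ w, ω (T x) w = μ * q x w := fun w => by
    rw [← hT, hx]; simp
  refine ⟨(t * m) • x, t • T x, t ^ 2 * m ^ 2 * q x x, ?_, ?_, ?_, ?_, fun w h1 h2 => ?_⟩
  · simp only [map_smul, LinearMap.smul_apply, smul_eq_mul]
    rw [← hT, hμN, ← hmμ]
    linear_combination htm
  · simp only [map_smul, LinearMap.smul_apply, smul_eq_mul]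
    ring
  · simp only [map_smul, LinearMap.smul_apply, smul_eq_mul]
    rw [hμN, ← hmμ]
    ring
  · simp [hxTx]
  · simp only [map_smul, LinearMap.smul_apply, smul_eq_mul, hmul, ← hT, mul_eq_zero, ht.ne',
      hm.ne', (neg_pos.1 hμ).ne, false_or] at h1 h2 ⊢
    exact ⟨h2, h1⟩

/-- The conclusion of `exists_symplectic_plane_of_posDef` for a positive semidefinite `q` with
symplectic kernel. -/
lemma exists_symplectic_plane {V : Type*} [AddCommGroup V] [Module ℝ V]
    [FiniteDimensional ℝ V] [Nontrivial V] {ω q : LinearMap.BilinForm ℝ V}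
    (ha : ∀ x y, ω x y = -ω y x) (hnd : ∀ x, (∀ y, ω x y = 0) → x = 0)
    (hs : ∀ x y, q x y = q y x) (hp : ∀ x, 0 ≤ q x x)
    (hk : ∀ x, (∀ y, q x y = 0) → x ≠ 0 → ∃ y, (∀ z, q y z = 0) ∧ ω x y ≠ 0) :
    ∃ (u v : V) (d : ℝ), ω u v = 1 ∧ q u u = d ∧ q v v = d ∧ q u v = 0 ∧
      ∀ w, ω u w = 0 → ω v w = 0 → q u w = 0 ∧ q v w = 0 := by
  by_cases hd : ∀ x, q x x = 0 → x = 0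
  · exact exists_symplectic_plane_of_posDef ha hnd hs hp hd
  push Not at hd
  obtain ⟨x, hx, hx0⟩ := hd
  have hqx := apply_eq_zero_of_apply_self_eq_zero hs hp hx
  obtain ⟨y, hqy, hxy⟩ := hk x hqx hx0
  refine ⟨x, (ω x y)⁻¹ • y, 0, ?_, hx, ?_, hqx _, fun w _ _ => ⟨hqx w, ?_⟩⟩
  · simp [hxy]
  · simp [hqy]
  · simp [hqy]

/-- Dimension of the `ω`-complement of a symplectic plane. -/
lemma finrank_ker_prod_of_symplectic_plane {V : Type*} [AddCommGroup V] [Module ℝ V]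
    [FiniteDimensional ℝ V] {ω : LinearMap.BilinForm ℝ V} (ha : ∀ x y, ω x y = -ω y x) {u v : V}
    (huv : ω u v = 1) :
    Module.finrank ℝ (LinearMap.ker ((ω u).prod (ω v))) + 2 = Module.finrank ℝ V := by
  have hsurj : LinearMap.range ((ω u).prod (ω v)) = ⊤ := by
    refine LinearMap.range_eq_top.2 fun ⟨a, b⟩ => ⟨a • v - b • u, ?_⟩
    have huu : ω u u = 0 := by linarith [ha u u]
    have hvv : ω v v = 0 := by linarith [ha v v]
    have hvu : ω v u = -1 := by rw [ha, huv]
    ext <;> simp [huu, hvv, hvu, huv]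
  have h := ((ω u).prod (ω v)).finrank_range_add_finrank_ker
  rw [hsurj, finrank_top, Module.finrank_prod, Module.finrank_self] at h
  omega

/-- Simultaneous diagonalization of a symplectic form and a positive semidefinite form with
symplectic kernel. -/
theorem exists_symplectic_diagonalization {V : Type*} [AddCommGroup V] [Module ℝ V]
    [FiniteDimensional ℝ V] {n : ℕ} (hV : Module.finrank ℝ V = 2 * n) {ω q : LinearMap.BilinForm ℝ V}
    (ha : ∀ x y, ω x y = -ω y x) (hnd : ∀ x, (∀ y, ω x y = 0) → x = 0)
    (hs : ∀ x y, q x y = q y x) (hp : ∀ x, 0 ≤ q x x)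
    (hk : ∀ x, (∀ y, q x y = 0) → x ≠ 0 → ∃ y, (∀ z, q y z = 0) ∧ ω x y ≠ 0) :
    ∃ (e f : Fin n → V) (d : Fin n → ℝ), ∀ i j,
      ω (e i) (e j) = 0 ∧ ω (f i) (f j) = 0 ∧ ω (e i) (f j) = (1 : Matrix _ _ ℝ) i j ∧
      q (e i) (e j) = diagonal d i j ∧ q (f i) (f j) = diagonal d i j ∧ q (e i) (f j) = 0 := by
  induction n generalizing V with
  | zero => exact ⟨0, 0, 0, fun i => i.elim0⟩
  | succ n ih =>
    have : Nontrivial V := Module.nontrivial_of_finrank_pos (R := ℝ) (by omega)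
    obtain ⟨u, v, d, huv, hu, hv, hquv, hW⟩ := exists_symplectic_plane ha hnd hs hp hk
    have huu : ω u u = 0 := by linarith [ha u u]
    have hvv : ω v v = 0 := by linarith [ha v v]
    have hvu : ω v u = -1 := by rw [ha, huv]
    let W := LinearMap.ker ((ω u).prod (ω v))
    have mem_W : ∀ w, w ∈ W ↔ ω u w = 0 ∧ ω v w = 0 := fun w => by
      simp [W, LinearMap.mem_ker]
    have hωu : ∀ w : W, ω u w = 0 := fun w => ((mem_W w).1 w.2).1
    have hωv : ∀ w : W, ω v w = 0 := fun w => ((mem_W w).1 w.2).2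
    have hqu : ∀ w : W, q u w = 0 := fun w => (hW w (hωu w) (hωv w)).1
    have hqv : ∀ w : W, q v w = 0 := fun w => (hW w (hωu w) (hωv w)).2
    have hωu' : ∀ w : W, ω w u = 0 := fun w => by rw [ha, hωu, neg_zero]
    have hωv' : ∀ w : W, ω w v = 0 := fun w => by rw [ha, hωv, neg_zero]
    have hqu' : ∀ w : W, q w u = 0 := fun w => by rw [hs, hqu]
    have hqv' : ∀ w : W, q w v = 0 := fun w => by rw [hs, hqv]
    have decomp : ∀ y : V, ∃ (a b : ℝ) (w : W), y = a • u + b • v + w := fun y => by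
      refine ⟨-ω v y, ω u y, ⟨y - (-ω v y • u + ω u y • v), (mem_W _).2 ⟨?_, ?_⟩⟩, ?_⟩
      · simp [huu, huv]
      · simp [hvv, hvu]
      · simp
    obtain ⟨e, f, D, h⟩ := ih (V := W) (ω := ω.restrict W) (q := q.restrict W)
      (by have : _ + 2 = _ := finrank_ker_prod_of_symplectic_plane ha huv
          change Module.finrank ℝ W + 2 = _ at this
          omega)
      (fun x y => ha x y)
      (fun x hx => by
        refine Subtype.ext (hnd x fun y => ?_)
        obtain ⟨a, b, w, rfl⟩ := decomp y
        have := hx w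
        simp only [LinearMap.BilinForm.restrict_apply, LinearMap.domRestrict_apply] at this
        simp [hωu', hωv', this])
      (fun x y => hs x y) (fun x => hp x)
      (fun x hx hx0 => by
        obtain ⟨y, hy, hxy⟩ := hk x (fun y => by
          obtain ⟨a, b, w, rfl⟩ := decomp y
          have := hx w
          simp only [LinearMap.BilinForm.restrict_apply, LinearMap.domRestrict_apply] at this
          simp [hqu', hqv', this]) (fun h => hx0 (Subtype.ext h))
        obtain ⟨a, b, w, rfl⟩ := decomp y
        refine ⟨w, fun z => ?_, ?_⟩
        · simpa [hqu, hqv] using hy z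
        · simpa [hωu', hωv'] using hxy)
    simp only [LinearMap.BilinForm.restrict_apply, LinearMap.domRestrict_apply] at h
    refine ⟨Fin.cons u fun i => e i, Fin.cons v fun i => f i, Fin.cons d D, fun i j => ?_⟩
    cases i using Fin.cases <;> cases j using Fin.cases <;>
      simp [huu, hvv, huv, hu, hv, hquv, hωu, hωv, hωu', hωv', hqu, hqv, hqu', hqv', h,
        diagonal_apply, one_apply, Fin.succ_ne_zero, (Fin.succ_ne_zero _).symm]

lemma jm_mul_jm (ι : Type*) [Fintype ι] [DecidableEq ι] : Jm ι * Jm ι = -1 := by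
  simp [Jm, fromBlocks_multiply, ← fromBlocks_one, fromBlocks_neg]

lemma transpose_jm (ι : Type*) [Fintype ι] [DecidableEq ι] : (Jm ι)ᵀ = -Jm ι := by
  simp [Jm, fromBlocks_transpose, fromBlocks_neg]

lemma dotProduct_jm_mulVec_comm {ι : Type*} [Fintype ι] [DecidableEq ι] (x y : ι ⊕ ι → ℝ) :
    x ⬝ᵥ Jm ι *ᵥ y = -(y ⬝ᵥ Jm ι *ᵥ x) := by
  rw [dotProduct_mulVec, ← mulVec_transpose, transpose_jm, neg_mulVec, neg_dotProduct,
    dotProduct_comm]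

/-- The inverse of a symplectic matrix `M` is `-J Mᵀ J`. -/
lemma IsSymplectic.inv_mul {ι : Type*} [Fintype ι] [DecidableEq ι]
    {M : Matrix (ι ⊕ ι) (ι ⊕ ι) ℝ} (hM : IsSymplectic M) :
    -(Jm ι * Mᵀ * Jm ι) * M = 1 := by
  rw [IsSymplectic] at hM
  rw [Matrix.neg_mul, Matrix.mul_assoc, Matrix.mul_assoc, ← Matrix.mul_assoc Mᵀ, hM, jm_mul_jm,
    neg_neg]

/-- Symplectic congruence of `A` is similarity of `J A`. -/
lemma IsSymplectic.charpoly_jm_mul_sq {ι : Type*} [Fintype ι] [DecidableEq ι]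
    {M A N : Matrix (ι ⊕ ι) (ι ⊕ ι) ℝ} (hM : IsSymplectic M) (hN : Mᵀ * A * M = N) :
    (Jm ι * N * (Jm ι * N)).charpoly = (Jm ι * A * (Jm ι * A)).charpoly := by
  have hl := hM.inv_mul
  let U : (Matrix (ι ⊕ ι) (ι ⊕ ι) ℝ)ˣ := ⟨M, _, mul_eq_one_comm.1 hl, hl⟩
  have hJN : Jm ι * N = -(Jm ι * Mᵀ * Jm ι) * (Jm ι * A) * M := by
    rw [← hN, Matrix.neg_mul, Matrix.mul_assoc (Jm ι * Mᵀ), ← Matrix.mul_assoc (Jm ι) (Jm ι),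
      jm_mul_jm]
    simp only [Matrix.neg_mul, Matrix.mul_neg, neg_neg, Matrix.one_mul, Matrix.mul_assoc]
  have h : Jm ι * N * (Jm ι * N) = U⁻¹.val * (Jm ι * A * (Jm ι * A)) * U.val := by
    have hr : M * -(Jm ι * Mᵀ * Jm ι) = 1 := mul_eq_one_comm.1 hl
    change _ = -(Jm ι * Mᵀ * Jm ι) * _ * M
    rw [hJN]
    generalize -(Jm ι * Mᵀ * Jm ι) = L at hr
    calc L * (Jm ι * A) * M * (L * (Jm ι * A) * M)
        = L * (Jm ι * A) * (M * L) * (Jm ι * A) * M := by simp only [Matrix.mul_assoc]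
      _ = L * (Jm ι * A * (Jm ι * A)) * M := by
        rw [hr, Matrix.mul_one]; simp only [Matrix.mul_assoc]
  rw [h, coe_units_inv, charpoly_units_conj']

open Polynomial in
lemma roots_charpoly_jm_mul_diagonal_sq {ι : Type*} [Fintype ι] [DecidableEq ι] (d : ι → ℝ) :
    (Jm ι * fromBlocks (diagonal d) 0 0 (diagonal d) *
      (Jm ι * fromBlocks (diagonal d) 0 0 (diagonal d))).charpoly.roots =
    2 • Finset.univ.val.map (fun i => -(d i) ^ 2) := by
  have h : Jm ι * fromBlocks (diagonal d) 0 0 (diagonal d) *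
      (Jm ι * fromBlocks (diagonal d) 0 0 (diagonal d)) =
      fromBlocks (diagonal fun i => -(d i) ^ 2) 0 0 (diagonal fun i => -(d i) ^ 2) := by
    simp only [Jm, fromBlocks_multiply]
    simp [pow_two]
  have hroots : (∏ i, (X - C (-(d i) ^ 2))).roots =
      Finset.univ.val.map (fun i => -(d i) ^ 2) := by
    have := roots_multiset_prod_X_sub_C (Finset.univ.val.map (fun i => -(d i) ^ 2))
    rwa [Multiset.map_map] at this
  rw [h, charpoly_fromBlocks_zero₁₂, charpoly_diagonal, ← pow_two, roots_pow, hroots]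

/-- Two families with the same multiset of values differ by a permutation. -/
lemma exists_perm_of_map_univ_eq {ι α : Type*} [Fintype ι] [DecidableEq α] {f g : ι → α}
    (h : Finset.univ.val.map f = Finset.univ.val.map g) : ∃ σ : Equiv.Perm ι, f = g ∘ σ := by
  have hc : ∀ c, Nonempty ({i // f i = c} ≃ {i // g i = c}) := fun c => by
    refine Fintype.card_eq.1 ?_
    have := congrArg (Multiset.count c) h
    simp only [Multiset.count_map, eq_comm (a := c)] at this
    rw [Fintype.card_subtype, Fintype.card_subtype]
    exact this
  let e := fun c => (hc c).some
  exact ⟨Equiv.ofFiberEquiv e, funext fun i => (Equiv.ofFiberEquiv_map e i).symm⟩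

lemma nonneg_of_symplectic_diagonalization {ι : Type*} [Fintype ι] [DecidableEq ι]
    {A M : Matrix (ι ⊕ ι) (ι ⊕ ι) ℝ} (hA : A.PosSemidef) {d : ι → ℝ}
    (h : Mᵀ * A * M = fromBlocks (diagonal d) 0 0 (diagonal d)) (i : ι) : 0 ≤ d i := by
  have hp := hA.conjTranspose_mul_mul_same M
  rw [conjTranspose_eq_transpose_of_trivial, h] at hp
  simpa using hp.diag_nonneg (i := Sum.inl i)

/-- The symplectic eigenvalues of a positive semidefinite matrix are unique up to permutation. -/
theorem exists_perm_of_symplectic_diagonalizations {ι : Type*} [Fintype ι] [DecidableEq ι]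
    {A M₁ M₂ : Matrix (ι ⊕ ι) (ι ⊕ ι) ℝ} (hA : A.PosSemidef) {d₁ d₂ : ι → ℝ}
    (hM₁ : IsSymplectic M₁) (hM₂ : IsSymplectic M₂)
    (h₁ : M₁ᵀ * A * M₁ = fromBlocks (diagonal d₁) 0 0 (diagonal d₁))
    (h₂ : M₂ᵀ * A * M₂ = fromBlocks (diagonal d₂) 0 0 (diagonal d₂)) :
    ∃ σ : Equiv.Perm ι, d₁ = d₂ ∘ σ := by
  have h := congrArg Polynomial.roots
    ((hM₁.charpoly_jm_mul_sq h₁).trans (hM₂.charpoly_jm_mul_sq h₂).symm)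
  rw [roots_charpoly_jm_mul_diagonal_sq, roots_charpoly_jm_mul_diagonal_sq] at h
  have hsq : Finset.univ.val.map (fun i => -(d₁ i) ^ 2) =
      Finset.univ.val.map (fun i => -(d₂ i) ^ 2) := by
    ext c
    have := congrArg (Multiset.count c) h
    simp only [Multiset.count_nsmul] at this
    omega
  obtain ⟨σ, hσ⟩ := exists_perm_of_map_univ_eq hsq
  refine ⟨σ, funext fun i => ?_⟩
  have hi := congrFun hσ i
  simp only [Function.comp_apply, neg_inj] at hi
  exact (pow_left_inj₀ (nonneg_of_symplectic_diagonalization hA h₁ i)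
    (nonneg_of_symplectic_diagonalization hA h₂ _) two_ne_zero).1 hi

/-- Existence of a symplectic diagonalization of a positive semidefinite matrix with symplectic
kernel. -/
theorem HasSymplecticKernel.exists_isSympSpectrum {n : ℕ}
    {A : Matrix (Fin n ⊕ Fin n) (Fin n ⊕ Fin n) ℝ} (hpsd : A.PosSemidef)
    (hker : HasSymplecticKernel A) : ∃ d, IsSympSpectrum A d := by
  have hsymm : Aᵀ = A := by
    simpa [IsHermitian, conjTranspose_eq_transpose_of_trivial] using hpsd.isHermitian
  have hs : ∀ x y, x ⬝ᵥ A *ᵥ y = y ⬝ᵥ A *ᵥ x := fun x y => by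
    rw [dotProduct_mulVec, ← mulVec_transpose, hsymm, dotProduct_comm]
  have hkerA : ∀ x, (∀ y, x ⬝ᵥ A *ᵥ y = 0) → A *ᵥ x = 0 := fun x hx =>
    dotProduct_eq_zero _ fun y => by rw [dotProduct_comm, hs, hx]
  obtain ⟨e, f, d, h⟩ := exists_symplectic_diagonalization (V := Fin n ⊕ Fin n → ℝ) (n := n)
    (ω := toBilin' (Jm (Fin n))) (q := toBilin' A)
    (by simp [two_mul])
    (fun x y => by simpa only [toBilin'_apply'] using dotProduct_jm_mulVec_comm x y)
    (fun x hx => by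
      simp only [toBilin'_apply'] at hx
      refine dotProduct_eq_zero _ fun y => ?_
      have := hx (-(Jm (Fin n) *ᵥ y))
      rwa [mulVec_neg, mulVec_mulVec, jm_mul_jm, neg_mulVec, one_mulVec, neg_neg] at this)
    (fun x y => by simpa only [toBilin'_apply'] using hs x y)
    (fun x => by
      simpa only [toBilin'_apply', star_trivial] using hpsd.dotProduct_mulVec_nonneg x)
    (fun x hx hx0 => by
      simp only [toBilin'_apply'] at hx ⊢
      obtain ⟨y, hy, hxy⟩ := hker x (hkerA x hx) hx0
      have hy : A *ᵥ y = 0 := hy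
      exact ⟨y, fun z => by rw [hs, hy, dotProduct_zero], hxy⟩)
  simp only [toBilin'_apply'] at h
  let M : Matrix (Fin n ⊕ Fin n) (Fin n ⊕ Fin n) ℝ := (of (Sum.elim e f))ᵀ
  have entry : ∀ (B : Matrix (Fin n ⊕ Fin n) (Fin n ⊕ Fin n) ℝ) s t,
      (Mᵀ * B * M) s t = Sum.elim e f s ⬝ᵥ B *ᵥ Sum.elim e f t := fun B s t => by
    rw [Matrix.mul_assoc, mul_apply, dotProduct]
    rfl
  refine ⟨d, M, ?_, ?_⟩
  · ext s t
    rw [entry]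
    rcases s with i | i <;> rcases t with j | j
    · simpa [Jm] using (h i j).1
    · simpa [Jm] using (h i j).2.2.1
    · rw [dotProduct_jm_mulVec_comm]
      simpa [Jm, one_apply, eq_comm] using (h j i).2.2.1
    · simpa [Jm] using (h i j).2.1
  · ext s t
    rw [entry]
    rcases s with i | i <;> rcases t with j | j
    · simpa using (h i j).2.2.2.1
    · simpa using (h i j).2.2.2.2.2
    · rw [hs]
      simpa using (h j i).2.2.2.2.2
    · simpa using (h i j).2.2.2.2.1

/-- Williamson's theorem for positive semidefinite matrices with symplectic kernel:
existence of a symplectic diagonalization with non-negative diagonal, unique up to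
permutation. -/
theorem stmt0 {n : ℕ} (A : Matrix (Fin n ⊕ Fin n) (Fin n ⊕ Fin n) ℝ)
    (hsymm : A.IsSymm) (hpsd : A.PosSemidef) (hker : HasSymplecticKernel A) :
    (∃ (M : Matrix (Fin n ⊕ Fin n) (Fin n ⊕ Fin n) ℝ) (D : Fin n → ℝ),
      IsSymplectic M ∧ (∀ i, 0 ≤ D i) ∧
      Mᵀ * A * M = Matrix.fromBlocks (Matrix.diagonal D) 0 0 (Matrix.diagonal D)) ∧
    (∀ (M₁ M₂ : Matrix (Fin n ⊕ Fin n) (Fin n ⊕ Fin n) ℝ) (D₁ D₂ : Fin n → ℝ),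
      IsSymplectic M₁ → IsSymplectic M₂ →
      M₁ᵀ * A * M₁ = Matrix.fromBlocks (Matrix.diagonal D₁) 0 0 (Matrix.diagonal D₁) →
      M₂ᵀ * A * M₂ = Matrix.fromBlocks (Matrix.diagonal D₂) 0 0 (Matrix.diagonal D₂) →
      ∃ σ : Equiv.Perm (Fin n), D₁ = D₂ ∘ σ) := by
  obtain ⟨D, M, hM, hD⟩ := hker.exists_isSympSpectrum hpsd
  exact ⟨⟨M, D, hM, nonneg_of_symplectic_diagonalization hpsd hD, hD⟩,
    fun M₁ M₂ D₁ D₂ => exists_perm_of_symplectic_diagonalizations hpsd⟩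
end

section
/- Let A and B be 2n×2n real symmetric positive semidefinite matrices with symplectic kernels. If A lies in the convex hull of the symplectic orbit of B, i.e., A = Σ_{i=1}^m λ_i M_i^T B M_i for symplectic matrices M_i and a probability vector (λ_1,...,λ_m), then d(A) is weakly supermajorized by d(B): for every 1 ≤ k ≤ n, the sum of the k smallest symplectic eigenvalues of A is at least the sum of the k smallest symplectic eigenvalues of B. -/
open Matrix BigOperators

section Symplectic

variable {ι : Type*} [Fintype ι] [DecidableEq ι]

theorem Jm_mul_Jm : Jm ι * Jm ι = -1 := by
  simp [Jm, Matrix.fromBlocks_multiply, ← Matrix.fromBlocks_one, Matrix.fromBlocks_neg]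

theorem Jm_mulVec_inl (v : ι ⊕ ι → ℝ) (j : ι) : (Jm ι *ᵥ v) (Sum.inl j) = v (Sum.inr j) := by
  simp [Jm, Matrix.fromBlocks_mulVec]

theorem Jm_mulVec_inr (v : ι ⊕ ι → ℝ) (j : ι) : (Jm ι *ᵥ v) (Sum.inr j) = -v (Sum.inl j) := by
  simp [Jm, Matrix.fromBlocks_mulVec, Matrix.neg_mulVec]

theorem Jm_mulVec_dotProduct_Jm_mulVec (v w : ι ⊕ ι → ℝ) :
    (Jm ι *ᵥ v) ⬝ᵥ (Jm ι *ᵥ w) = v ⬝ᵥ w := by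
  simp [dotProduct, Fintype.sum_sum_type, Jm_mulVec_inl, Jm_mulVec_inr, add_comm]

theorem dotProduct_Jm_mulVec (v w : ι ⊕ ι → ℝ) :
    v ⬝ᵥ (Jm ι *ᵥ w) = -(Jm ι *ᵥ v) ⬝ᵥ w := by
  simp [dotProduct, Fintype.sum_sum_type, Jm_mulVec_inl, Jm_mulVec_inr, add_comm]

theorem IsSymplectic.mul {M N : Matrix (ι ⊕ ι) (ι ⊕ ι) ℝ} (hM : IsSymplectic M)
    (hN : IsSymplectic N) : IsSymplectic (M * N) := by
  unfold IsSymplectic at *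
  calc (M * N)ᵀ * Jm ι * (M * N) = Nᵀ * (Mᵀ * Jm ι * M) * N := by
        simp only [Matrix.transpose_mul, Matrix.mul_assoc]
    _ = Jm ι := by rw [hM, hN]

/-- A symplectic matrix has a symplectic right inverse. -/
theorem IsSymplectic.exists_mul_eq_one {M : Matrix (ι ⊕ ι) (ι ⊕ ι) ℝ} (hM : IsSymplectic M) :
    ∃ L, IsSymplectic L ∧ M * L = 1 := by
  have hleft : -(Jm ι * Mᵀ * Jm ι) * M = 1 := by
    have : Jm ι * (Mᵀ * Jm ι * M) = -1 := by rw [hM, Jm_mul_Jm]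
    rw [neg_mul, neg_eq_iff_eq_neg, ← this]
    simp only [Matrix.mul_assoc]
  have hright := mul_eq_one_comm.mp hleft
  refine ⟨_, ?_, hright⟩
  generalize -(Jm ι * Mᵀ * Jm ι) = L at hright
  unfold IsSymplectic at *
  have ht : Lᵀ * Mᵀ = 1 := by rw [← Matrix.transpose_mul, hright, Matrix.transpose_one]
  calc Lᵀ * Jm ι * L = Lᵀ * (Mᵀ * Jm ι * M) * L := by rw [hM]
    _ = (Lᵀ * Mᵀ) * Jm ι * (M * L) := by simp only [Matrix.mul_assoc]
    _ = Jm ι := by rw [ht, hright]; simp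

end Symplectic

/-- An orthonormal basis of a subspace of `ℝ^κ`, together with Bessel's inequality. -/
theorem exists_unit_family_bessel {κ : Type*} [Fintype κ] (W : Submodule ℝ (κ → ℝ)) :
    ∃ v : Fin (Module.finrank ℝ W) → κ → ℝ, (∀ i, v i ∈ W) ∧ (∀ i, v i ⬝ᵥ v i = 1) ∧
      ∀ x : κ → ℝ, ∑ i, (x ⬝ᵥ v i) ^ 2 ≤ x ⬝ᵥ x := by
  let e := (WithLp.linearEquiv 2 ℝ (κ → ℝ)).symm
  let U : Submodule ℝ (EuclideanSpace ℝ κ) := W.map e.toLinearMap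
  have hU : Module.finrank ℝ U = Module.finrank ℝ W := LinearEquiv.finrank_map_eq e W
  let b := (stdOrthonormalBasis ℝ U).reindex (finCongr hU)
  have hb : Orthonormal ℝ (fun i => (b i : EuclideanSpace ℝ κ)) :=
    b.orthonormal.comp_linearIsometry U.subtypeₗᵢ
  have hinner (x y : EuclideanSpace ℝ κ) : inner ℝ x y = y.ofLp ⬝ᵥ x.ofLp := by
    simp [EuclideanSpace.inner_eq_star_dotProduct]
  refine ⟨fun i => (b i : EuclideanSpace ℝ κ).ofLp, fun i => ?_, fun i => ?_, fun x => ?_⟩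
  · obtain ⟨w, hw, hwe⟩ := (b i).2
    change e.symm (b i) ∈ W
    rw [← hwe]
    exact hw
  · rw [← hinner, real_inner_self_eq_norm_sq, hb.1 i]
    norm_num
  · have h := hb.sum_inner_products_le (WithLp.toLp 2 x) (s := Finset.univ)
    rw [← real_inner_self_eq_norm_sq] at h
    simpa only [hinner, Real.norm_eq_abs, sq_abs] using h

/-- The `(l, j)` entry is half the sum of the squares of the four `(l, j)` entries of the
`ι × ι` blocks of `N`. -/
noncomputable def sympSqMatrix {ι : Type*} (N : Matrix (ι ⊕ ι) (ι ⊕ ι) ℝ) :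
    Matrix ι ι ℝ := fun l j =>
  (N (.inl l) (.inl j) ^ 2 + N (.inl l) (.inr j) ^ 2 +
    N (.inr l) (.inl j) ^ 2 + N (.inr l) (.inr j) ^ 2) / 2

theorem sympSqMatrix_nonneg {ι : Type*} (N : Matrix (ι ⊕ ι) (ι ⊕ ι) ℝ) (l j : ι) :
    0 ≤ sympSqMatrix N l j := by
  unfold sympSqMatrix
  positivity

section SquareSums

variable {ι : Type*} [Fintype ι] [DecidableEq ι]

theorem exists_subspace_supported (N : Matrix (ι ⊕ ι) (ι ⊕ ι) ℝ) (S T : Finset ι) :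
    ∃ W : Submodule ℝ (ι ⊕ ι → ℝ),
      (∀ v ∈ W, (∀ j ∉ T, v (.inl j) = 0 ∧ v (.inr j) = 0) ∧
        (∀ l ∉ S, (N *ᵥ v) (.inl l) = 0 ∧ (N *ᵥ v) (.inr l) = 0)) ∧
      2 * (S.card + T.card) ≤ Module.finrank ℝ W + 2 * Fintype.card ι := by
  let rT : (ι ⊕ ι → ℝ) →ₗ[ℝ] ((Tᶜ : Finset ι) ⊕ (Tᶜ : Finset ι) → ℝ) :=
    LinearMap.funLeft ℝ ℝ (Sum.map Subtype.val Subtype.val)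
  let rS : (ι ⊕ ι → ℝ) →ₗ[ℝ] ((Sᶜ : Finset ι) ⊕ (Sᶜ : Finset ι) → ℝ) :=
    LinearMap.funLeft ℝ ℝ (Sum.map Subtype.val Subtype.val) ∘ₗ N.mulVecLin
  refine ⟨LinearMap.ker (rT.prod rS), fun v hv => ?_, ?_⟩
  · simp only [LinearMap.ker_prod, Submodule.mem_inf, LinearMap.mem_ker] at hv
    refine ⟨fun j hj => ⟨?_, ?_⟩, fun l hl => ⟨?_, ?_⟩⟩
    · exact congrFun hv.1 (.inl ⟨j, by simpa using hj⟩)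
    · exact congrFun hv.1 (.inr ⟨j, by simpa using hj⟩)
    · exact congrFun hv.2 (.inl ⟨l, by simpa using hl⟩)
    · exact congrFun hv.2 (.inr ⟨l, by simpa using hl⟩)
  · have h := LinearMap.finrank_range_add_finrank_ker (rT.prod rS)
    have hr := Submodule.finrank_le (LinearMap.range (rT.prod rS))
    simp only [Module.finrank_prod, Module.finrank_fintype_fun_eq_card, Fintype.card_sum,
      Fintype.card_coe, Finset.card_compl] at h hr
    have := S.card_le_univ
    have := T.card_le_univ
    omega

theorem IsSymplectic.dotProduct_self_le {N : Matrix (ι ⊕ ι) (ι ⊕ ι) ℝ} (hN : IsSymplectic N)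
    {S : Finset ι} {v : ι ⊕ ι → ℝ}
    (hv : ∀ l ∉ S, (N *ᵥ v) (.inl l) = 0 ∧ (N *ᵥ v) (.inr l) = 0) :
    v ⬝ᵥ v ≤ ∑ l ∈ S, ((N *ᵥ v) (.inl l) ^ 2 + (N *ᵥ v) (.inr l) ^ 2 +
      (N *ᵥ (Jm ι *ᵥ v)) (.inl l) ^ 2 + (N *ᵥ (Jm ι *ᵥ v)) (.inr l) ^ 2) / 2 := by
  have h : v ⬝ᵥ v = (N *ᵥ (Jm ι *ᵥ v)) ⬝ᵥ (Jm ι *ᵥ (N *ᵥ v)) := by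
    have hJ : Jm ι *ᵥ v = Nᵀ *ᵥ (Jm ι *ᵥ (N *ᵥ v)) := by
      rw [Matrix.mulVec_mulVec, Matrix.mulVec_mulVec, hN]
    calc v ⬝ᵥ v = (Jm ι *ᵥ v) ⬝ᵥ (Jm ι *ᵥ v) := (Jm_mulVec_dotProduct_Jm_mulVec v v).symm
      _ = (Jm ι *ᵥ v) ⬝ᵥ (Nᵀ *ᵥ (Jm ι *ᵥ (N *ᵥ v))) := by rw [← hJ]
      _ = _ := by rw [Matrix.dotProduct_mulVec, Matrix.vecMul_transpose]
  rw [h, dotProduct, Fintype.sum_sum_type, ← Finset.sum_add_distrib]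
  simp only [Jm_mulVec_inl, Jm_mulVec_inr]
  rw [← Finset.sum_subset S.subset_univ fun l _ hl => by simp [hv l hl]]
  gcongr with l
  nlinarith [sq_nonneg ((N *ᵥ (Jm ι *ᵥ v)) (.inl l) - (N *ᵥ v) (.inr l)),
    sq_nonneg ((N *ᵥ (Jm ι *ᵥ v)) (.inr l) + (N *ᵥ v) (.inl l))]

/-- The row set `S` and column set `T` of a symplectic matrix carry mass at least
`#S + #T - n`. -/
theorem IsSymplectic.card_add_card_le_sum {N : Matrix (ι ⊕ ι) (ι ⊕ ι) ℝ}
    (hN : IsSymplectic N) (S T : Finset ι) :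
    (S.card + T.card : ℝ) ≤ ∑ l ∈ S, ∑ j ∈ T, sympSqMatrix N l j + Fintype.card ι := by
  obtain ⟨W, hW, hdim⟩ := exists_subspace_supported N S T
  obtain ⟨v, hvW, hv1, hbessel⟩ := exists_unit_family_bessel W
  let x : ι ⊕ ι → ι ⊕ ι → ℝ := fun l =>
    Sum.elim (fun j => if j ∈ T then N l (.inl j) else 0)
      (fun j => if j ∈ T then N l (.inr j) else 0)
  have hx (w : ι ⊕ ι → ℝ) (hw : ∀ j ∉ T, w (.inl j) = 0 ∧ w (.inr j) = 0) (l : ι ⊕ ι) :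
      (N *ᵥ w) l = x l ⬝ᵥ w := by
    simp only [Matrix.mulVec, dotProduct]
    refine Finset.sum_congr rfl fun c _ => ?_
    rcases c with j | j <;> by_cases hj : j ∈ T <;> simp [x, hj, hw]
  have hNv (i) (l : ι ⊕ ι) : (N *ᵥ v i) l = x l ⬝ᵥ v i := hx _ (hW _ (hvW i)).1 l
  have hNJv (i) (l : ι ⊕ ι) : (N *ᵥ (Jm ι *ᵥ v i)) l = (-(Jm ι *ᵥ x l)) ⬝ᵥ v i := by
    rw [hx _ (fun j hj => ?_) l, dotProduct_Jm_mulVec]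
    simp [Jm_mulVec_inl, Jm_mulVec_inr, (hW _ (hvW i)).1 j hj]
  have hsum : (Module.finrank ℝ W : ℝ) ≤ ∑ i, ∑ l ∈ S,
      ((x (.inl l) ⬝ᵥ v i) ^ 2 + (x (.inr l) ⬝ᵥ v i) ^ 2 +
        (-(Jm ι *ᵥ x (.inl l)) ⬝ᵥ v i) ^ 2 + (-(Jm ι *ᵥ x (.inr l)) ⬝ᵥ v i) ^ 2) / 2 := by
    calc (Module.finrank ℝ W : ℝ) = ∑ i, v i ⬝ᵥ v i := by simp [hv1]
      _ ≤ _ := Finset.sum_le_sum fun i _ => by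
        simpa only [hNv, hNJv] using hN.dotProduct_self_le (hW _ (hvW i)).2
  have hle : (Module.finrank ℝ W : ℝ) ≤
      ∑ l ∈ S, (x (.inl l) ⬝ᵥ x (.inl l) + x (.inr l) ⬝ᵥ x (.inr l)) := by
    refine hsum.trans ?_
    rw [Finset.sum_comm]
    gcongr with l
    rw [← Finset.sum_div]
    simp only [Finset.sum_add_distrib]
    have hJ (y : ι ⊕ ι → ℝ) : (-(Jm ι *ᵥ y)) ⬝ᵥ (-(Jm ι *ᵥ y)) = y ⬝ᵥ y := by
      simp [Jm_mulVec_dotProduct_Jm_mulVec]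
    have h1 := hbessel (x (.inl l))
    have h2 := hbessel (x (.inr l))
    have h3 := hbessel (-(Jm ι *ᵥ x (.inl l)))
    have h4 := hbessel (-(Jm ι *ᵥ x (.inr l)))
    rw [hJ] at h3 h4
    linarith
  have hxE (l : ι) : x (.inl l) ⬝ᵥ x (.inl l) + x (.inr l) ⬝ᵥ x (.inr l) =
      2 * ∑ j ∈ T, sympSqMatrix N l j := by
    simp only [dotProduct, Fintype.sum_sum_type, x, Sum.elim_inl, Sum.elim_inr, mul_ite, ite_mul,
      mul_zero, zero_mul, Finset.sum_ite_mem, Finset.univ_inter, ← Finset.sum_add_distrib,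
      Finset.inter_self, Finset.mul_sum, sympSqMatrix]
    refine Finset.sum_congr rfl fun j hj => ?_
    ring
  simp only [hxE, ← Finset.mul_sum] at hle
  have hdim' : (2 * (S.card + T.card) : ℝ) ≤ Module.finrank ℝ W + 2 * Fintype.card ι := by
    exact_mod_cast hdim
  linarith

theorem diag_conj_fromBlocks_diagonal (N : Matrix (ι ⊕ ι) (ι ⊕ ι) ℝ) (d : ι → ℝ) (j : ι) :
    let C := Nᵀ * Matrix.fromBlocks (Matrix.diagonal d) 0 0 (Matrix.diagonal d) * N
    C (.inl j) (.inl j) + C (.inr j) (.inr j) = 2 * ∑ l, d l * sympSqMatrix N l j := by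
  simp only [Matrix.mul_apply, Fintype.sum_sum_type, Matrix.transpose_apply,
    Matrix.fromBlocks_apply₁₁, Matrix.fromBlocks_apply₁₂, Matrix.fromBlocks_apply₂₁,
    Matrix.fromBlocks_apply₂₂, Matrix.diagonal_apply, Matrix.zero_apply, mul_ite, mul_zero,
    Finset.sum_ite_eq', Finset.mem_univ, if_true, add_zero, zero_add,
    ← Finset.sum_add_distrib, Finset.mul_sum, sympSqMatrix]
  refine Finset.sum_congr rfl fun l _ => ?_
  ring

end SquareSums

/-- Abel summation: nonnegative tail sums pair nonnegatively with nonnegative monotone weights. -/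
theorem sum_mul_nonneg_of_tail_nonneg : ∀ {n : ℕ} (d u : Fin n → ℝ), Monotone d →
    (∀ i, 0 ≤ d i) → (∀ m : ℕ, 0 ≤ ∑ l with m ≤ l.val, u l) → 0 ≤ ∑ l, d l * u l
  | 0, _, _, _, _, _ => by simp
  | n + 1, d, u, hd, hd0, hu => by
    have hrec := sum_mul_nonneg_of_tail_nonneg (fun l : Fin n => d l.succ - d 0)
      (fun l => u l.succ) (fun a b hab => by simpa using hd (Fin.succ_le_succ_iff.mpr hab))
      (fun i => by simpa using hd (Fin.zero_le i.succ))
      (fun m => by simpa [Finset.sum_filter, Fin.sum_univ_succ] using hu (m + 1))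
    have htot : 0 ≤ ∑ l, u l := by simpa using hu 0
    have h := mul_nonneg (hd0 0) htot
    simp only [sub_mul, Finset.sum_sub_distrib, ← Finset.mul_sum] at hrec
    rw [Fin.sum_univ_succ] at h ⊢
    linarith

theorem IsSymplectic.sum_le_sum_sum_mul {n : ℕ} {N : Matrix (Fin n ⊕ Fin n) (Fin n ⊕ Fin n) ℝ}
    (hN : IsSymplectic N) {d : Fin n → ℝ} (hd : Monotone d) (hd0 : ∀ i, 0 ≤ d i) (k : ℕ) :
    ∑ j with j.val < k, d j ≤ ∑ j with j.val < k, ∑ l, d l * sympSqMatrix N l j := by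
  have key := sum_mul_nonneg_of_tail_nonneg d
    (fun l => ∑ j with j.val < k, sympSqMatrix N l j - if l.val < k then 1 else 0) hd hd0 ?_
  · simp only [mul_sub, Finset.sum_sub_distrib, mul_ite, mul_one, mul_zero, Finset.mul_sum]
      at key
    rw [Finset.sum_comm, Finset.sum_filter]
    linarith
  · intro m
    rw [Finset.sum_sub_distrib, sub_nonneg]
    rcases le_total k m with hkm | hmk
    · rw [Finset.sum_eq_zero fun l hl => if_neg ?_]
      · exact Finset.sum_nonneg fun l _ => Finset.sum_nonneg fun j _ => sympSqMatrix_nonneg N l j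
      · have := (Finset.mem_filter.mp hl).2
        omega
    · have h := hN.card_add_card_le_sum {l | m ≤ l.val} {j | j.val < k}
      rw [Finset.sum_boole]
      have hunion : (Finset.univ.filter fun l : Fin n => m ≤ l.val) ∪
          (Finset.univ.filter fun l : Fin n => l.val < k) = Finset.univ := by
        ext l
        simp only [Finset.mem_union, Finset.mem_filter, Finset.mem_univ, true_and, iff_true]
        omega
      have hcard := Finset.card_union_add_card_inter (Finset.univ.filter fun l : Fin n => m ≤ l.val)
        (Finset.univ.filter fun l : Fin n => l.val < k)
      rw [hunion, ← Finset.filter_and, ← Finset.filter_filter, Finset.card_univ] at hcard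
      have hcard' := congrArg (Nat.cast (R := ℝ)) hcard
      push_cast at hcard'
      linarith

/-- If `A` lies in the convex hull of the symplectic orbit of `B`, then
`d(A)` is weakly supermajorized by `d(B)`. -/
theorem stmt4 {n : ℕ} (A B : Matrix (Fin n ⊕ Fin n) (Fin n ⊕ Fin n) ℝ)
    (dA dB : Fin n → ℝ)
    (hAsymm : A.IsSymm) (hApsd : A.PosSemidef) (hAker : HasSymplecticKernel A)
    (hBsymm : B.IsSymm) (hBpsd : B.PosSemidef) (hBker : HasSymplecticKernel B)
    (hdA : IsSympSpectrum A dA) (hmA : Monotone dA)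
    (hdB : IsSympSpectrum B dB) (hmB : Monotone dB)
    (hhull : InSympHull B A) :
    ∀ k : ℕ, 1 ≤ k → k ≤ n →
      ∑ j ∈ Finset.univ.filter (fun j : Fin n => (j : ℕ) < k), dB j ≤
      ∑ j ∈ Finset.univ.filter (fun j : Fin n => (j : ℕ) < k), dA j := by
  intro k _ _
  obtain ⟨MA, hMA, hA⟩ := hdA
  obtain ⟨MB, hMB, hB⟩ := hdB
  obtain ⟨m, p, M, hp0, hp1, hM, hAsum⟩ := hhull
  obtain ⟨L, hL, hMBL⟩ := hMB.exists_mul_eq_one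
  have hdB0 (i : Fin n) : 0 ≤ dB i := by
    have h : (MBᵀ * B * MB).PosSemidef := by
      simpa using hBpsd.conjTranspose_mul_mul_same MB
    rw [hB] at h
    simpa using h.diag_nonneg (i := Sum.inl i)
  set D := Matrix.fromBlocks (Matrix.diagonal dB) 0 0 (Matrix.diagonal dB)
  have hBD : B = Lᵀ * D * L := by
    have ht : Lᵀ * MBᵀ = 1 := by rw [← Matrix.transpose_mul, hMBL, Matrix.transpose_one]
    calc B = (Lᵀ * MBᵀ) * B * (MB * L) := by rw [ht, hMBL]; simp
      _ = Lᵀ * D * L := by rw [← hB]; simp only [Matrix.mul_assoc]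
  let N := fun i => L * M i * MA
  have hN (i) : IsSymplectic (N i) := (hL.mul (hM i)).mul hMA
  have hAN : Matrix.fromBlocks (Matrix.diagonal dA) 0 0 (Matrix.diagonal dA) =
      ∑ i, p i • ((N i)ᵀ * D * N i) := by
    rw [← hA, hAsum, hBD, Finset.mul_sum, Finset.sum_mul]
    refine Finset.sum_congr rfl fun i _ => ?_
    simp only [N, Matrix.transpose_mul, Matrix.mul_smul, Matrix.smul_mul, Matrix.mul_assoc]
  have hdA (j : Fin n) : dA j = ∑ i, p i * ∑ l, dB l * sympSqMatrix (N i) l j := by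
    have h1 := congrFun (congrFun hAN (.inl j)) (.inl j)
    have h2 := congrFun (congrFun hAN (.inr j)) (.inr j)
    simp only [Matrix.fromBlocks_apply₁₁, Matrix.fromBlocks_apply₂₂, Matrix.diagonal_apply_eq,
      Matrix.sum_apply, Matrix.smul_apply, smul_eq_mul] at h1 h2
    have h : 2 * dA j = 2 * ∑ i, p i * ∑ l, dB l * sympSqMatrix (N i) l j := by
      rw [two_mul]
      nth_rewrite 1 [h1]
      rw [h2, ← Finset.sum_add_distrib, Finset.mul_sum]
      refine Finset.sum_congr rfl fun i _ => ?_
      rw [← mul_add, diag_conj_fromBlocks_diagonal (N i) dB j]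
      ring
    linarith
  calc ∑ j with j.val < k, dB j = ∑ i, p i * ∑ j with j.val < k, dB j := by
        rw [← Finset.sum_mul, hp1, one_mul]
    _ ≤ ∑ i, p i * ∑ j with j.val < k, ∑ l, dB l * sympSqMatrix (N i) l j :=
        Finset.sum_le_sum fun i _ =>
          mul_le_mul_of_nonneg_left ((hN i).sum_le_sum_sum_mul hmB hdB0 k) (hp0 i)
    _ = ∑ j with j.val < k, dA j := by
        simp only [hdA, Finset.mul_sum]
        rw [Finset.sum_comm]
end
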